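/- arXiv:1907.11614 — 2 statements merged into one kernel-verified Lean document; each statement's English description precedes it below -/
import Mathlib

section
/- Let a > 1, b ≥ 1 and a' > 1, b' ≥ 1 be integers. If J''_{a,b} = J''_{a',b'} in ℤ[t], then (a,b) = (a',b'). That is, the polynomials J''_{a,b} for a > 1, b ≥ 1 are pairwise distinct. -/
open Polynomial

/-- Normalized Jones polynomial of the knot `K_{a,b}` (for `a ≥ b ≥ 1`). -/
noncomputable def J (a b : ℕ) : Polynomial ℤ :=
  1 - X - X ^ (a + b + 2) + X ^ (a + b + 3) + X ^ (a * b + 2 * b + 1)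
    - X ^ (a * b + a + b + 1) - X ^ (a * b + a + b + 3) + X ^ (a * b + 2 * a + 1)

/-- Normalized Jones polynomial of the knot `K'_{a,b}` (for `a ≥ b ≥ 1`). -/
noncomputable def J' (a b : ℕ) : Polynomial ℤ :=
  -1 + X + X ^ (a + b) - X ^ (a + b + 1) + X ^ (a * b + 2 * b)
    - X ^ (a * b + a + b) - X ^ (a * b + a + b + 2) + X ^ (a * b + 2 * a)

/-- Normalized Jones polynomial of the knot `K''_{a,b}` (for `a > 1`, `b ≥ 1`). -/
noncomputable def J'' (a b : ℕ) : Polynomial ℤ :=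
  1 - X ^ (a + b) - X ^ (a + b + 2) + X ^ (2 * a + 2 * b)
    - X ^ (a * b + a + b + 1) + X ^ (a * b + a + b + 2)
    + X ^ (a * b + 2 * a - 1) - X ^ (a * b + 2 * a)

/-- Normalized Jones polynomial of the torus knot `T(n,n+1)` (for `n ≥ 2`). -/
noncomputable def Θ (n : ℕ) : Polynomial ℤ :=
  1 - X ^ (n + 1) - X ^ (n + 2) + X ^ (2 * n + 1)

theorem eval_one_derivative_derivative_X_pow (n : ℕ) :
    (derivative (derivative (X ^ n : Polynomial ℤ))).eval 1 = (n : ℤ) * (n - 1) := by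
  cases n <;> simp [derivative_X_pow]

theorem eval_one_derivative_derivative_J'' {a : ℕ} (b : ℕ) (ha : 1 < a) :
    (derivative (derivative (J'' a b))).eval 1 =
      2 * ((a + b : ℤ) * (a + b - 1) - 2 * a + 1) := by
  have hcast : ((a * b + 2 * a - 1 : ℕ) : ℤ) = a * b + 2 * a - 1 := by
    rw [Nat.cast_sub (by nlinarith)]
    push_cast
    ring
  simp only [J'', derivative_add, derivative_sub, eval_add, eval_sub, derivative_one,
    derivative_zero, eval_zero, eval_one_derivative_derivative_X_pow, hcast]
  push_cast
  ring

/-- With `s = a + b`, the values of `s * (s - 1) - 2 * a` for a given `s` lie strictly below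
those for any larger `s`. -/
theorem add_le_add_of_quadratic_eq {a b a' b' : ℤ} (ha : 1 ≤ a) (hb : 0 ≤ b) (ha' : 1 ≤ a')
    (hb' : 1 ≤ b')
    (h : (a + b) * (a + b - 1) - 2 * a = (a' + b') * (a' + b' - 1) - 2 * a') :
    a' + b' ≤ a + b := by
  by_contra! hlt
  nlinarith [mul_nonneg (by lia : 0 ≤ a' + b' - (a + b) - 1) (by lia : 0 ≤ a' + b' + (a + b) - 2)]

/-- the polynomials `J''_{a,b}`, `a > 1`, `b ≥ 1`, are pairwise distinct. -/
theorem stmt_10 (a b a' b' : ℕ) (ha : 1 < a) (hb : 1 ≤ b) (ha' : 1 < a') (hb' : 1 ≤ b')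
    (h : J'' a b = J'' a' b') : a = a' ∧ b = b' := by
  have h2 := congrArg (fun p => (derivative (derivative p)).eval 1) h
  simp only [eval_one_derivative_derivative_J'' _ ha, eval_one_derivative_derivative_J'' _ ha']
    at h2
  have hs : (a + b : ℤ) = a' + b' := le_antisymm
    (add_le_add_of_quadratic_eq (by lia) (by lia) (by lia) (by lia) (by linarith))
    (add_le_add_of_quadratic_eq (by lia) (by lia) (by lia) (by lia) (by linarith))
  rw [hs] at h2
  lia
end

section
/- Let S ⊆ ℤ[t] be the set S := {Θ_n : n ≥ 2} ∪ {J_{a,b} : a ≥ b ≥ 1} ∪ {J'_{a,b} : a ≥ b ≥ 1} ∪ {J''_{a,b} : a > 1, b ≥ 1}. For a nonzero polynomial P with nonzero constant term define its mirror M(P) := −t^{deg P}·P(t^{−1}) (i.e. minus the polynomial with the coefficient sequence of P reversed). Then for P ∈ S one has M(P) ∈ S if and only if P ∈ {Θ_2, J_{1,1}, J_{2,1}, J'_{1,1}, J'_{3,1}, J''_{2,1}}. (Explicitly: M(Θ_2) = J'_{1,1} and M(J'_{1,1}) = Θ_2; M(J'_{3,1}) = J''_{2,1} and M(J''_{2,1})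 = J'_{3,1}; M(J_{1,1}) = J_{1,1} and M(J_{2,1}) = J_{2,1}; and for every other P ∈ S, M(P) ∉ S.) -/
open Polynomial

/-- The set of normalized Jones polynomials of all knots with Hopf crossing
number at most one. -/
def S : Set (Polynomial ℤ) :=
  {P | ∃ n : ℕ, 2 ≤ n ∧ P = Θ n} ∪ {P | ∃ a b : ℕ, 1 ≤ b ∧ b ≤ a ∧ P = J a b} ∪
    {P | ∃ a b : ℕ, 1 ≤ b ∧ b ≤ a ∧ P = J' a b} ∪
    {P | ∃ a b : ℕ, 1 < a ∧ 1 ≤ b ∧ P = J'' a b}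

/-- The mirror operation `M(P) = −t^{deg P}·P(t⁻¹)`, i.e. minus the polynomial with
the reversed coefficient sequence. -/
noncomputable def M (P : Polynomial ℤ) : Polynomial ℤ := -P.reverse

lemma coeff_J (a b k : ℕ) : (J a b).coeff k =
    (if k = 0 then 1 else 0) - (if k = 1 then 1 else 0) - (if k = a + b + 2 then 1 else 0)
      + (if k = a + b + 3 then 1 else 0) + (if k = a * b + 2 * b + 1 then 1 else 0)
      - (if k = a * b + a + b + 1 then 1 else 0) - (if k = a * b + a + b + 3 then 1 else 0)
      + (if k = a * b + 2 * a + 1 then 1 else 0) := by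
  simp only [J, coeff_add, coeff_sub, coeff_X_pow, coeff_one, coeff_X, eq_comm (a := 1)]

lemma coeff_J' (a b k : ℕ) : (J' a b).coeff k =
    -(if k = 0 then 1 else 0) + (if k = 1 then 1 else 0) + (if k = a + b then 1 else 0)
      - (if k = a + b + 1 then 1 else 0) + (if k = a * b + 2 * b then 1 else 0)
      - (if k = a * b + a + b then 1 else 0) - (if k = a * b + a + b + 2 then 1 else 0)
      + (if k = a * b + 2 * a then 1 else 0) := by
  simp only [J', coeff_add, coeff_sub, coeff_neg, coeff_X_pow, coeff_one, coeff_X,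
    eq_comm (a := 1)]

lemma coeff_J'' (a b k : ℕ) : (J'' a b).coeff k =
    (if k = 0 then 1 else 0) - (if k = a + b then 1 else 0) - (if k = a + b + 2 then 1 else 0)
      + (if k = 2 * a + 2 * b then 1 else 0) - (if k = a * b + a + b + 1 then 1 else 0)
      + (if k = a * b + a + b + 2 then 1 else 0) + (if k = a * b + 2 * a - 1 then 1 else 0)
      - (if k = a * b + 2 * a then 1 else 0) := by
  simp only [J'', coeff_add, coeff_sub, coeff_X_pow, coeff_one]

lemma coeff_Θ (n k : ℕ) : (Θ n).coeff k =
    (if k = 0 then 1 else 0) - (if k = n + 1 then 1 else 0) - (if k = n + 2 then 1 else 0)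
      + (if k = 2 * n + 1 then 1 else 0) := by
  simp only [Θ, coeff_add, coeff_sub, coeff_X_pow, coeff_one]

/-- `P` and `Q` have degree `d` and are mirror images of each other. -/
structure IsMirror (d : ℕ) (P Q : ℤ[X]) : Prop where
  coeff_left : P.coeff d ≠ 0
  coeff_right : Q.coeff d ≠ 0
  left_zero : ∀ k, d < k → P.coeff k = 0
  right_zero : ∀ k, d < k → Q.coeff k = 0
  coeff_eq : ∀ i j, i + j = d → Q.coeff i = -P.coeff j

lemma IsMirror.symm {d : ℕ} {P Q : ℤ[X]} (h : IsMirror d P Q) : IsMirror d Q P where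
  coeff_left := h.coeff_right
  coeff_right := h.coeff_left
  left_zero := h.right_zero
  right_zero := h.left_zero
  coeff_eq i j hij := by rw [h.coeff_eq j i (by omega), neg_neg]

lemma isMirror_M {P : ℤ[X]} (h0 : P.coeff 0 ≠ 0) : IsMirror P.natDegree P (M P) := by
  have hP : P ≠ 0 := by rintro rfl; simp at h0
  have key : ∀ i j, i + j = P.natDegree → (M P).coeff i = -P.coeff j := by
    intro i j hij
    rw [M, coeff_neg, coeff_reverse, revAt_le (by omega), ← hij, Nat.add_sub_cancel_left]
  refine ⟨by simpa using hP, ?_, fun k hk => coeff_eq_zero_of_natDegree_lt hk, ?_, key⟩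
  · rw [key _ 0 (by simp)]
    simpa using h0
  · intro k hk
    have := reverse_natDegree_le P
    rw [M, coeff_neg, coeff_eq_zero_of_natDegree_lt (by omega), neg_zero]

lemma IsMirror.M_eq {d : ℕ} {P Q : ℤ[X]} (h : IsMirror d P Q) : M P = Q := by
  have hd : P.natDegree = d :=
    natDegree_eq_of_le_of_coeff_ne_zero (natDegree_le_iff_coeff_eq_zero.2 h.left_zero) h.coeff_left
  ext k
  rw [M, coeff_neg, coeff_reverse, hd]
  rcases le_or_gt k d with hk | hk
  · rw [revAt_le hk, h.coeff_eq k (d - k) (by omega)]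
  · rw [revAt_eq_self_of_lt hk, h.left_zero k hk, h.right_zero k hk, neg_zero]

lemma IsMirror.degree_eq {d D : ℕ} {P Q : ℤ[X]} (h : IsMirror d P Q) (hD : P.coeff D ≠ 0)
    (hz : ∀ k, D < k → P.coeff k = 0) : d = D := by
  rcases lt_trichotomy d D with hlt | heq | hgt
  · exact absurd (h.left_zero D hlt) hD
  · exact heq
  · exact absurd (hz d hgt) h.coeff_left

lemma M_Θ_two : M (Θ 2) = J' 1 1 := by
  refine IsMirror.M_eq (d := 5) ⟨?_, ?_, ?_, ?_, ?_⟩ <;> intros <;>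
    simp only [coeff_Θ, coeff_J', if_true] at * <;> omega

lemma M_J'_three_one : M (J' 3 1) = J'' 2 1 := by
  refine IsMirror.M_eq (d := 7) ⟨?_, ?_, ?_, ?_, ?_⟩ <;> intros <;>
    simp only [coeff_J'', coeff_J', if_true] at * <;> omega

lemma M_J_one_one : M (J 1 1) = J 1 1 := by
  refine IsMirror.M_eq (d := 6) ⟨?_, ?_, ?_, ?_, ?_⟩ <;> intros <;>
    simp only [coeff_J, if_true] at * <;> omega

lemma M_J_two_one : M (J 2 1) = J 2 1 := by
  refine IsMirror.M_eq (d := 8) ⟨?_, ?_, ?_, ?_, ?_⟩ <;> intros <;>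
    simp only [coeff_J, if_true] at * <;> omega

lemma low_coeff_J {a b : ℕ} (hb : 1 ≤ b) (hab : b ≤ a) :
    (J a b).coeff 0 = 1 ∧ (J a b).coeff 1 = -1 ∧ (J a b).coeff 2 = 0 := by
  have := Nat.mul_pos (hb.trans hab) hb
  simp only [coeff_J, if_true]
  generalize a * b = m at *
  refine ⟨?_, ?_, ?_⟩ <;> omega

lemma low_coeff_J' {a b : ℕ} (hb : 1 ≤ b) (hab : b ≤ a) :
    (J' a b).coeff 0 = -1 ∧ (J' a b).coeff 1 = 1 := by
  have := Nat.mul_pos (hb.trans hab) hb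
  simp only [coeff_J', if_true]
  generalize a * b = m at *
  refine ⟨?_, ?_⟩ <;> omega

lemma low_coeff_J'' {a b : ℕ} (ha : 1 < a) (hb : 1 ≤ b) :
    (J'' a b).coeff 0 = 1 ∧ (J'' a b).coeff 1 = 0 ∧ (J'' a b).coeff 2 = 0 := by
  have := Nat.mul_pos (zero_lt_one.trans ha) hb
  simp only [coeff_J'', if_true]
  generalize a * b = m at *
  refine ⟨?_, ?_, ?_⟩ <;> omega

lemma low_coeff_Θ {n : ℕ} (hn : 2 ≤ n) :
    (Θ n).coeff 0 = 1 ∧ (Θ n).coeff 1 = 0 ∧ (Θ n).coeff 2 = 0 := by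
  simp only [coeff_Θ, if_true]
  refine ⟨?_, ?_, ?_⟩ <;> omega

lemma low_coeff_S {Q : ℤ[X]} (hQ : Q ∈ S) :
    (Q.coeff 0 = 1 ∧ (Q.coeff 1 = -1 ∨ Q.coeff 1 = 0) ∧ Q.coeff 2 = 0) ∨
      (Q.coeff 0 = -1 ∧ Q.coeff 1 = 1 ∧ ∃ a b : ℕ, 1 ≤ b ∧ b ≤ a ∧ Q = J' a b) := by
  rcases hQ with ((⟨n, hn, rfl⟩ | ⟨a, b, hb, hab, rfl⟩) | ⟨a, b, hb, hab, rfl⟩) |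
    ⟨a, b, ha, hb, rfl⟩
  · obtain ⟨h0, h1, h2⟩ := low_coeff_Θ hn
    exact .inl ⟨h0, .inr h1, h2⟩
  · obtain ⟨h0, h1, h2⟩ := low_coeff_J hb hab
    exact .inl ⟨h0, .inl h1, h2⟩
  · obtain ⟨h0, h1⟩ := low_coeff_J' hb hab
    exact .inr ⟨h0, h1, a, b, hb, hab, rfl⟩
  · obtain ⟨h0, h1, h2⟩ := low_coeff_J'' ha hb
    exact .inl ⟨h0, .inr h1, h2⟩

lemma coeff_zero_ne_zero_of_mem_S {Q : ℤ[X]} (hQ : Q ∈ S) : Q.coeff 0 ≠ 0 := by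
  rcases low_coeff_S hQ with ⟨h, -⟩ | ⟨h, -⟩ <;> simp [h]

lemma J'_eq_two_one {a b : ℕ} (hb : 1 ≤ b) (hab : b ≤ a) (h2 : (J' a b).coeff 2 = 0)
    (h3 : (J' a b).coeff 3 = 1) : a = 2 ∧ b = 1 := by
  have := Nat.le_mul_of_pos_right a hb
  by_cases ha : a = 1
  · obtain rfl : b = 1 := by omega
    subst ha
    simp [coeff_J'] at h2
  · simp only [coeff_J'] at h2 h3
    generalize a * b = m at *
    omega

lemma IsMirror.not_J' {d : ℕ} {P Q : ℤ[X]} (h : IsMirror (d + 8) P Q) (h2 : P.coeff (d + 6) = 0)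
    (h3 : P.coeff (d + 5) = -1) (hQ : ∃ a b : ℕ, 1 ≤ b ∧ b ≤ a ∧ Q = J' a b) : False := by
  obtain ⟨a, b, hb, hab, rfl⟩ := hQ
  obtain ⟨rfl, rfl⟩ := J'_eq_two_one hb hab (by rw [h.coeff_eq 2 (d + 6) (by omega), h2, neg_zero])
    (by rw [h.coeff_eq 3 (d + 5) (by omega), h3, neg_neg])
  apply h.coeff_right
  simp only [coeff_J']
  omega

lemma IsMirror.coeff_top {d : ℕ} {P Q : ℤ[X]} (h : IsMirror d P Q) (hQ : Q ∈ S) (D : ℕ)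
    (hD : P.coeff (D + 2) ≠ 0) (hz : ∀ k, D + 2 < k → P.coeff k = 0) :
    d = D + 2 ∧
      ((P.coeff (D + 2) = -1 ∧ (P.coeff (D + 1) = 1 ∨ P.coeff (D + 1) = 0) ∧ P.coeff D = 0) ∨
      (P.coeff (D + 2) = 1 ∧ P.coeff (D + 1) = -1 ∧
        ∃ a b : ℕ, 1 ≤ b ∧ b ≤ a ∧ Q = J' a b)) := by
  obtain rfl := h.degree_eq hD hz
  have h0 := h.coeff_eq 0 (D + 2) (by omega)
  have h1 := h.coeff_eq 1 (D + 1) (by omega)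
  have h2 := h.coeff_eq 2 D (by omega)
  rcases low_coeff_S hQ with ⟨k0, k1, k2⟩ | ⟨k0, k1, hJ⟩
  · exact ⟨rfl, .inl (by omega)⟩
  · exact ⟨rfl, .inr ⟨by omega, by omega, hJ⟩⟩

lemma mul_self_eq_or_le (b : ℕ) (hb : 1 ≤ b) : b * b = b ∧ b = 1 ∨ 2 * b ≤ b * b ∧ 2 ≤ b := by
  rcases Nat.lt_or_ge b 2 with hb2 | hb2
  · obtain rfl : b = 1 := by omega
    simp
  · exact .inr ⟨Nat.mul_le_mul_right b hb2, hb2⟩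

lemma J_three_one : J 3 1 = J 2 1 := by
  unfold J
  ring

lemma mirror_J {a b d : ℕ} (hb : 1 ≤ b) (hab : b ≤ a) {Q : ℤ[X]} (hQ : Q ∈ S)
    (h : IsMirror d (J a b) Q) : J a b = J 1 1 ∨ J a b = J 2 1 := by
  have hm := coeff_J a b
  have hbb := mul_self_eq_or_le b hb
  by_contra! hne
  have h11 : ¬ (a = 1 ∧ b = 1) := by rintro ⟨rfl, rfl⟩; exact hne.1 rfl
  have h21 : ¬ (a = 2 ∧ b = 1) := by rintro ⟨rfl, rfl⟩; exact hne.2 rfl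
  have h31 : ¬ (a = 3 ∧ b = 1) := by rintro ⟨rfl, rfl⟩; exact hne.2 J_three_one
  clear hne
  obtain ⟨δ, rfl⟩ := Nat.exists_eq_add_of_le hab
  rw [add_mul] at hm
  have hδ : δ = 0 ∨ δ = 1 ∨ δ = 2 ∨ δ = 3 ∨ 4 ≤ δ := by omega
  rcases hδ with rfl | rfl | rfl | rfl | hδ
  · obtain ⟨rfl, ⟨h0, h1, h2⟩ | ⟨h0, h1, -⟩⟩ := h.coeff_top hQ (b * b + 2 * b + 1)
      (by rw [hm]; omega) (by intro k hk; rw [hm]; omega)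
    · rw [hm] at h2; omega
    · rw [hm] at h0; omega
  · obtain ⟨rfl, ⟨h0, h1, h2⟩ | ⟨h0, h1, -⟩⟩ := h.coeff_top hQ (b * b + 3 * b + 2)
      (by rw [hm]; omega) (by intro k hk; rw [hm]; omega)
    · rw [hm] at h2; omega
    · rw [hm] at h0; omega
  · obtain ⟨rfl, ⟨h0, h1, h2⟩ | ⟨h0, h1, -⟩⟩ := h.coeff_top hQ (b * b + 4 * b + 1)
      (by rw [hm]; omega) (by intro k hk; rw [hm]; omega)
    · rw [hm] at h2; omega
    · rw [hm] at h0; omega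
  · obtain ⟨rfl, ⟨h0, h1, h2⟩ | ⟨h0, h1, hJ⟩⟩ := h.coeff_top hQ (b * b + 5 * b + 5)
      (by rw [hm]; omega) (by intro k hk; rw [hm]; omega)
    · rw [hm] at h0; omega
    · obtain ⟨e, he⟩ : ∃ e, b * b + 5 * b + 5 + 2 = e + 8 := ⟨b * b + 5 * b - 1, by omega⟩
      rw [he] at h
      exact h.not_J' (by rw [hm]; omega) (by rw [hm]; omega) hJ
  · have hr : 4 * b ≤ δ * b := Nat.mul_le_mul_right b hδ
    have hr' : δ ≤ δ * b := Nat.le_mul_of_pos_right δ hb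
    obtain ⟨rfl, ⟨h0, h1, h2⟩ | ⟨h0, h1, -⟩⟩ := h.coeff_top hQ (b * b + δ * b + 2 * b + 2 * δ - 1)
      (by rw [hm]; omega) (by intro k hk; rw [hm]; omega)
    · rw [hm] at h0; omega
    · rw [hm] at h1; omega

lemma mirror_J' {a b d : ℕ} (hb : 1 ≤ b) (hab : b ≤ a) {Q : ℤ[X]} (hQ : Q ∈ S)
    (h : IsMirror d (J' a b) Q) : J' a b = J' 1 1 ∨ J' a b = J' 3 1 := by
  have hm := coeff_J' a b
  have hbb := mul_self_eq_or_le b hb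
  by_contra! hne
  have h11 : ¬ (a = 1 ∧ b = 1) := by rintro ⟨rfl, rfl⟩; exact hne.1 rfl
  have h31 : ¬ (a = 3 ∧ b = 1) := by rintro ⟨rfl, rfl⟩; exact hne.2 rfl
  clear hne
  obtain ⟨δ, rfl⟩ := Nat.exists_eq_add_of_le hab
  rw [add_mul] at hm
  have hδ : δ = 0 ∨ δ = 1 ∨ δ = 2 ∨ δ = 3 ∨ 4 ≤ δ := by omega
  rcases hδ with rfl | rfl | rfl | rfl | hδ
  · obtain ⟨rfl, ⟨h0, h1, h2⟩ | ⟨h0, h1, -⟩⟩ := h.coeff_top hQ (b * b + 2 * b)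
      (by rw [hm]; omega) (by intro k hk; rw [hm]; omega)
    · rw [hm] at h2; omega
    · rw [hm] at h0; omega
  · obtain ⟨rfl, ⟨h0, h1, h2⟩ | ⟨h0, h1, -⟩⟩ := h.coeff_top hQ (b * b + 3 * b + 1)
      (by rw [hm]; omega) (by intro k hk; rw [hm]; omega)
    · rw [hm] at h2; omega
    · rw [hm] at h0; omega
  · obtain ⟨rfl, ⟨h0, h1, h2⟩ | ⟨h0, h1, -⟩⟩ := h.coeff_top hQ (b * b + 4 * b)
      (by rw [hm]; omega) (by intro k hk; rw [hm]; omega)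
    · rw [hm] at h2; omega
    · rw [hm] at h0; omega
  · obtain ⟨rfl, ⟨h0, h1, h2⟩ | ⟨h0, h1, hJ⟩⟩ := h.coeff_top hQ (b * b + 5 * b + 4)
      (by rw [hm]; omega) (by intro k hk; rw [hm]; omega)
    · rw [hm] at h0; omega
    · obtain ⟨e, he⟩ : ∃ e, b * b + 5 * b + 4 + 2 = e + 8 := ⟨b * b + 5 * b - 2, by omega⟩
      rw [he] at h
      exact h.not_J' (by rw [hm]; omega) (by rw [hm]; omega) hJ
  · have hr : 4 * b ≤ δ * b := Nat.mul_le_mul_right b hδ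
    have hr' : δ ≤ δ * b := Nat.le_mul_of_pos_right δ hb
    obtain ⟨rfl, ⟨h0, h1, h2⟩ | ⟨h0, h1, -⟩⟩ := h.coeff_top hQ (b * b + δ * b + 2 * b + 2 * δ - 2)
      (by rw [hm]; omega) (by intro k hk; rw [hm]; omega)
    · rw [hm] at h0; omega
    · rw [hm] at h1; omega

lemma mirror_Θ {n d : ℕ} (hn : 2 ≤ n) {Q : ℤ[X]} (hQ : Q ∈ S) (h : IsMirror d (Θ n) Q) :
    n = 2 := by
  have hm := coeff_Θ n
  obtain ⟨rfl, ⟨h0, h1, h2⟩ | ⟨h0, h1, -⟩⟩ := h.coeff_top hQ (2 * n - 1)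
    (by rw [hm]; omega) (by intro k hk; rw [hm]; omega)
  · rw [hm] at h0; omega
  · rw [hm] at h1; omega

/-- The mirror image of a `J''` is not a `J''`: if `J'' a b` has leading coefficient `-1`,
then `b + 2 < a` and the next coefficient is positive. -/
lemma not_isMirror_J'' {a b c e d : ℕ} (ha : 1 < a) (hb : 1 ≤ b) (hc : 1 < c) (he : 1 ≤ e)
    (h : IsMirror d (J'' a b) (J'' c e)) : False := by
  have hm := coeff_J'' a b
  obtain ⟨k0, k1, -⟩ := low_coeff_J'' hc he
  have hlead : (J'' a b).coeff d = -1 := by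
    rw [h.coeff_eq 0 d (zero_add d)] at k0
    omega
  have hd : 1 ≤ d := by
    by_contra hd
    obtain rfl : d = 0 := by omega
    rw [(low_coeff_J'' ha hb).1] at hlead
    omega
  have hsub : (J'' a b).coeff (d - 1) = 0 := by
    rw [h.coeff_eq 1 (d - 1) (by omega)] at k1
    omega
  have hma : a ≤ a * b := Nat.le_mul_of_pos_right a hb
  have hab : a = 2 ∧ a * b = 2 * b ∨ 3 * b ≤ a * b ∧ 3 ≤ a := by
    rcases Nat.lt_or_ge a 3 with h3 | h3
    · obtain rfl : a = 2 := by omega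
      exact .inl ⟨rfl, rfl⟩
    · exact .inr ⟨Nat.mul_le_mul_right b h3, h3⟩
  rcases Nat.lt_or_ge (b + 2) a with hlt | hge
  · obtain rfl := h.degree_eq (D := a * b + 2 * a)
      (by rw [hm]; omega) (by intro k hk; rw [hm]; omega)
    rw [hm] at hsub
    omega
  · by_cases heq : a = b + 2
    · obtain rfl := h.degree_eq (D := 2 * a + 2 * b)
        (by rw [hm]; omega) (by intro k hk; rw [hm]; omega)
      rw [hm] at hlead
      omega
    · obtain rfl := h.degree_eq (D := a * b + a + b + 2)
        (by rw [hm]; omega) (by intro k hk; rw [hm]; omega)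
      rw [hm] at hlead
      omega

/-- for `P ∈ S`, the mirror `M(P)` lies in `S` exactly for the six
polynomials `Θ_2, J_{1,1}, J_{2,1}, J'_{1,1}, J'_{3,1}, J''_{2,1}`; explicitly
`M` swaps `Θ_2 ↔ J'_{1,1}` and `J'_{3,1} ↔ J''_{2,1}` and fixes `J_{1,1}`, `J_{2,1}`. -/
theorem stmt_13 :
    (∀ P ∈ S, (M P ∈ S ↔
      P = Θ 2 ∨ P = J 1 1 ∨ P = J 2 1 ∨ P = J' 1 1 ∨ P = J' 3 1 ∨ P = J'' 2 1)) ∧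
    M (Θ 2) = J' 1 1 ∧ M (J' 1 1) = Θ 2 ∧ M (J' 3 1) = J'' 2 1 ∧ M (J'' 2 1) = J' 3 1 ∧
    M (J 1 1) = J 1 1 ∧ M (J 2 1) = J 2 1 := by
  have hΘ : Θ 2 ∈ S := .inl (.inl (.inl ⟨2, by omega, rfl⟩))
  have hJ11 : J 1 1 ∈ S := .inl (.inl (.inr ⟨1, 1, by omega, by omega, rfl⟩))
  have hJ21 : J 2 1 ∈ S := .inl (.inl (.inr ⟨2, 1, by omega, by omega, rfl⟩))
  have hJ'11 : J' 1 1 ∈ S := .inl (.inr ⟨1, 1, by omega, by omega, rfl⟩)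
  have hJ'31 : J' 3 1 ∈ S := .inl (.inr ⟨3, 1, by omega, by omega, rfl⟩)
  have hJ''21 : J'' 2 1 ∈ S := .inr ⟨2, 1, by omega, by omega, rfl⟩
  have hM {P Q : ℤ[X]} (hP : P ∈ S) (hPQ : M P = Q) : M Q = P := by
    subst hPQ
    exact (isMirror_M (coeff_zero_ne_zero_of_mem_S hP)).symm.M_eq
  have e1 := M_Θ_two
  have e2 := hM hΘ e1
  have e3 := M_J'_three_one
  have e4 := hM hJ'31 e3
  have e5 := M_J_one_one
  have e6 := M_J_two_one
  refine ⟨fun P hP => ⟨fun hMP => ?_, ?_⟩, e1, e2, e3, e4, e5, e6⟩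
  · have h := isMirror_M (coeff_zero_ne_zero_of_mem_S hP)
    have hback := h.symm.M_eq
    rcases hP with ((⟨n, hn, rfl⟩ | ⟨a, b, hb, hab, rfl⟩) | ⟨a, b, hb, hab, rfl⟩) |
      ⟨a, b, ha, hb, rfl⟩
    · obtain rfl := mirror_Θ hn hMP h
      exact .inl rfl
    · rcases mirror_J hb hab hMP h with h' | h' <;> simp [h']
    · rcases mirror_J' hb hab hMP h with h' | h' <;> simp [h']
    · have hP : J'' a b ∈ S := .inr ⟨a, b, ha, hb, rfl⟩
      generalize M (J'' a b) = Q at *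
      rcases hMP with ((⟨n, hn, rfl⟩ | ⟨c, e, he, hce, rfl⟩) | ⟨c, e, he, hce, rfl⟩) |
        ⟨c, e, hc, he, rfl⟩
      · obtain rfl := mirror_Θ hn hP h.symm
        simp [← hback, e1]
      · rcases mirror_J he hce hP h.symm with h' | h' <;> simp [← hback, h', e5, e6]
      · rcases mirror_J' he hce hP h.symm with h' | h' <;> simp [← hback, h', e2, e3]
      · exact (not_isMirror_J'' ha hb hc he h).elim
  · rintro (rfl | rfl | rfl | rfl | rfl | rfl)
    · rwa [e1]
    · rwa [e5]
    · rwa [e6]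
    · rwa [e2]
    · rwa [e3]
    · rwa [e4]
end
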